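/- Let 1 ≤ m ≤ n. Summing over all sequences of partitions ∅ = λ^{(0)} ≺ λ^{(1)} ≺ ⋯ ≺ λ^{(m)} = ν̄^{(n)} ≻ μ^{(n)} ≻ ν̄^{(n−1)} ≻ μ^{(n−1)} ≻ ⋯ ≻ ν̄^{(1)} ≻ μ^{(1)} ≻ ν̄^{(0)} = ∅ subject to ℓ(ν̄^{(j)}) ≤ j for all 1 ≤ j ≤ n (i.e. over symplectic plane partitions in the m×2n box), one has Σ q^{ Σ_{i=1}^{m} |λ^{(i)}| + Σ_{j=1}^{n} |μ^{(j)}| − Σ_{j=0}^{n−1} |ν̄^{(j)}| } = ∏_{1≤i<j≤m} (1 − q^{i+j+1}) / ( ∏_{i=1}^{m} (1−q^i)^n (1−q^{i+1})^n ), as an identity of formal power series in q. -/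

import Mathlib

noncomputable section

open scoped BigOperators

/-- `Interlace a b` means `a ≻ b`, i.e. `a₁ ≥ b₁ ≥ a₂ ≥ b₂ ≥ ⋯`. -/
def Interlace {m : ℕ} (a b : Fin m → ℕ) : Prop :=
  (∀ i, b i ≤ a i) ∧ ∀ i : ℕ, ∀ h : i + 1 < m, a ⟨i + 1, h⟩ ≤ b ⟨i, by omega⟩

/-- The weight `|λ| = Σᵢ λᵢ` of a partition. -/
def wt {m : ℕ} (l : Fin m → ℕ) : ℕ := ∑ i, l i

/-- A symplectic plane partition in the `m × 2n` box (`m ≤ n`): an interlacing sequence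
`∅ = λ⁽⁰⁾ ≺ λ⁽¹⁾ ≺ ⋯ ≺ λ⁽ᵐ⁾ = ν̄⁽ⁿ⁾ ≻ μ⁽ⁿ⁾ ≻ ν̄⁽ⁿ⁻¹⁾ ≻ μ⁽ⁿ⁻¹⁾ ≻ ⋯ ≻ ν̄⁽¹⁾ ≻ μ⁽¹⁾ ≻ ν̄⁽⁰⁾ = ∅`
with `ℓ(ν̄⁽ʲ⁾) ≤ j`.  Here `p.1 k = λ⁽ᵏ⁾`, `p.2.1 k = μ⁽ᵏ⁺¹⁾` and `p.2.2 k = ν̄⁽ᵏ⁾`; all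
partitions are recorded with (at most) `m` parts. -/
def SympPP (m n : ℕ) : Type :=
  {p : (Fin (m + 1) → Fin m → ℕ) × (Fin n → Fin m → ℕ) × (Fin (n + 1) → Fin m → ℕ) //
    (∀ k, Antitone (p.1 k)) ∧ (∀ k, Antitone (p.2.1 k)) ∧ (∀ k, Antitone (p.2.2 k)) ∧
    p.1 0 = (fun _ => 0) ∧ p.2.2 0 = (fun _ => 0) ∧
    p.1 (Fin.last m) = p.2.2 (Fin.last n) ∧
    (∀ k : Fin m, Interlace (p.1 k.succ) (p.1 k.castSucc)) ∧
    (∀ k : Fin n, Interlace (p.2.2 k.succ) (p.2.1 k)) ∧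
    (∀ k : Fin n, Interlace (p.2.1 k) (p.2.2 k.castSucc)) ∧
    (∀ k : Fin (n + 1), ∀ i : Fin m, (k : ℕ) ≤ (i : ℕ) → p.2.2 k i = 0)}

/-! ### Coefficients of power series at integer indices -/

/-- The coefficient of a power series at an integer index (zero at negative indices). -/
def intCoeff (F : PowerSeries ℂ) (p : ℤ) : ℂ :=
  if p < 0 then 0 else PowerSeries.coeff p.toNat F

/-- The polynomial `1 - t z`. -/
def oneSubMulX (t : ℂ) : PowerSeries ℂ := 1 - PowerSeries.C t * PowerSeries.X

/-- The geometric series `1 / (1 - t z)`. -/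
def geomPowerSeries (t : ℂ) : PowerSeries ℂ := PowerSeries.mk fun n => t ^ n

lemma intCoeff_of_neg (F : PowerSeries ℂ) {p : ℤ} (hp : p < 0) : intCoeff F p = 0 := by
  simp [intCoeff, hp]

lemma intCoeff_natCast (F : PowerSeries ℂ) (l : ℕ) :
    intCoeff F l = PowerSeries.coeff l F := by
  simp [intCoeff]

lemma intCoeff_zero (F : PowerSeries ℂ) : intCoeff F 0 = PowerSeries.constantCoeff F := by
  simpa using intCoeff_natCast F 0

lemma coeff_oneSubMulX_mul_succ (t : ℂ) (F : PowerSeries ℂ) (l : ℕ) :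
    PowerSeries.coeff (l + 1) (oneSubMulX t * F)
      = PowerSeries.coeff (l + 1) F - t * PowerSeries.coeff l F := by
  rw [oneSubMulX, sub_mul, one_mul, map_sub, mul_assoc, PowerSeries.coeff_C_mul,
    PowerSeries.coeff_succ_X_mul]

lemma intCoeff_oneSubMulX_mul (t : ℂ) (F : PowerSeries ℂ) (p : ℤ) :
    intCoeff (oneSubMulX t * F) p = intCoeff F p - t * intCoeff F (p - 1) := by
  rcases lt_or_ge p 0 with hp | hp
  · rw [intCoeff_of_neg _ hp, intCoeff_of_neg _ hp, intCoeff_of_neg _ (by omega)]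
    simp
  · lift p to ℕ using hp
    cases p with
    | zero => simp [intCoeff, oneSubMulX]
    | succ l =>
      rw [show ((l + 1 : ℕ) : ℤ) - 1 = (l : ℤ) by push_cast; ring]
      simp only [intCoeff_natCast, coeff_oneSubMulX_mul_succ]

lemma oneSubMulX_mul_geomPowerSeries (t : ℂ) : oneSubMulX t * geomPowerSeries t = 1 := by
  ext l
  cases l with
  | zero => simp [oneSubMulX, geomPowerSeries]
  | succ l =>
    rw [coeff_oneSubMulX_mul_succ]
    simp [geomPowerSeries, PowerSeries.coeff_one, pow_succ']

lemma constantCoeff_oneSubMulX (t : ℂ) : PowerSeries.constantCoeff (oneSubMulX t) = 1 := by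
  simp [oneSubMulX]

lemma constantCoeff_geomPowerSeries (t : ℂ) :
    PowerSeries.constantCoeff (geomPowerSeries t) = 1 := by
  simp [geomPowerSeries, ← PowerSeries.coeff_zero_eq_constantCoeff_apply]

/-! ### Evaluation in the open unit disc -/

/-- The power series converges absolutely in the open unit disc. -/
def DiscSummable (F : PowerSeries ℂ) : Prop :=
  ∀ x : ℂ, ‖x‖ < 1 → Summable fun l => ‖PowerSeries.coeff l F * x ^ l‖

/-- The value of a power series at a point. -/
def evalAt (F : PowerSeries ℂ) (x : ℂ) : ℂ := ∑' l, PowerSeries.coeff l F * x ^ l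

lemma coeff_mul_mul_pow (F G : PowerSeries ℂ) (x : ℂ) (l : ℕ) :
    PowerSeries.coeff l (F * G) * x ^ l = ∑ kl ∈ Finset.HasAntidiagonal.antidiagonal l,
      (PowerSeries.coeff kl.1 F * x ^ kl.1) * (PowerSeries.coeff kl.2 G * x ^ kl.2) := by
  rw [PowerSeries.coeff_mul, Finset.sum_mul]
  refine Finset.sum_congr rfl fun kl h => ?_
  rw [← Finset.HasAntidiagonal.mem_antidiagonal.mp h, pow_add]
  ring

lemma DiscSummable.mul {F G : PowerSeries ℂ} (hF : DiscSummable F) (hG : DiscSummable G) :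
    DiscSummable (F * G) := by
  intro x hx
  have h := summable_norm_sum_mul_antidiagonal_of_summable_norm (hF x hx) (hG x hx)
  exact h.congr fun l => by rw [coeff_mul_mul_pow]

lemma evalAt_mul {F G : PowerSeries ℂ} (hF : DiscSummable F) (hG : DiscSummable G) {x : ℂ}
    (hx : ‖x‖ < 1) : evalAt (F * G) x = evalAt F x * evalAt G x := by
  simp only [evalAt, coeff_mul_mul_pow]
  exact (tsum_mul_tsum_eq_tsum_sum_antidiagonal_of_summable_norm (hF x hx) (hG x hx)).symm

lemma hasSum_evalAt_one (x : ℂ) :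
    HasSum (fun l => PowerSeries.coeff l (1 : PowerSeries ℂ) * x ^ l) 1 := by
  convert hasSum_ite_eq (0 : ℕ) (1 : ℂ) using 2 with l
  by_cases h : l = 0 <;> simp [PowerSeries.coeff_one, h]

lemma evalAt_one (x : ℂ) : evalAt 1 x = 1 := (hasSum_evalAt_one x).tsum_eq

lemma discSummable_one : DiscSummable 1 := fun x _ => (hasSum_evalAt_one x).summable.norm

lemma hasSum_evalAt_oneSubMulX (t x : ℂ) :
    HasSum (fun l => PowerSeries.coeff l (oneSubMulX t) * x ^ l) (1 - t * x) := by
  have h : ∀ l ∉ Finset.range 2, PowerSeries.coeff l (oneSubMulX t) * x ^ l = 0 := by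
    intro l hl
    obtain ⟨l, rfl⟩ : ∃ r, l = r + 2 := ⟨l - 2, by simp at hl; omega⟩
    simp [oneSubMulX, PowerSeries.coeff_one]
  have hval : 1 - t * x = ∑ l ∈ Finset.range 2, PowerSeries.coeff l (oneSubMulX t) * x ^ l := by
    simp [Finset.sum_range_succ, oneSubMulX, PowerSeries.coeff_one]
    ring
  rw [hval]
  exact hasSum_sum_of_ne_finset_zero h

lemma evalAt_oneSubMulX (t x : ℂ) : evalAt (oneSubMulX t) x = 1 - t * x :=
  (hasSum_evalAt_oneSubMulX t x).tsum_eq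

lemma discSummable_oneSubMulX (t : ℂ) : DiscSummable (oneSubMulX t) :=
  fun x _ => (hasSum_evalAt_oneSubMulX t x).summable.norm

lemma discSummable_geomPowerSeries {t : ℂ} (ht : ‖t‖ ≤ 1) : DiscSummable (geomPowerSeries t) := by
  intro x hx
  have h : ‖t * x‖ < 1 := by
    rw [norm_mul]
    nlinarith [norm_nonneg t, norm_nonneg x]
  simpa [geomPowerSeries, mul_pow] using (summable_geometric_of_lt_one (norm_nonneg _) h)

lemma DiscSummable.pow {F : PowerSeries ℂ} (hF : DiscSummable F) (k : ℕ) :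
    DiscSummable (F ^ k) := by
  induction k with
  | zero => simpa using discSummable_one
  | succ k ih => simpa [pow_succ] using ih.mul hF

lemma evalAt_pow {F : PowerSeries ℂ} (hF : DiscSummable F) {x : ℂ} (hx : ‖x‖ < 1) (k : ℕ) :
    evalAt (F ^ k) x = evalAt F x ^ k := by
  induction k with
  | zero => simp [evalAt_one]
  | succ k ih => rw [pow_succ, evalAt_mul (hF.pow k) hF hx, ih, pow_succ]

/-- The tail sum `∑_{r ≥ 0} x^r F_{p + r}`. -/
def tailSum (x : ℂ) (F : PowerSeries ℂ) (p : ℤ) : ℂ := ∑' r : ℕ, x ^ r * intCoeff F (p + r)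

lemma summable_tailSum {F : PowerSeries ℂ} (hF : DiscSummable F) {x : ℂ} (hx : ‖x‖ < 1) (p : ℤ) :
    Summable fun r : ℕ => x ^ r * intCoeff F (p + r) := by
  rcases eq_or_ne x 0 with rfl | hx0
  · exact summable_of_ne_finset_zero (s := {0}) fun r hr => by
      simp [show r ≠ 0 by simpa using hr]
  obtain ⟨a, b, rfl⟩ : ∃ a b : ℕ, p = (b : ℤ) - a := ⟨(-p).toNat, p.toNat, by omega⟩
  rw [← summable_nat_add_iff a]
  have h := ((summable_nat_add_iff b).2 (hF x hx).of_norm).mul_left (x ^ a * (x ^ b)⁻¹)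
  refine h.congr fun r => ?_
  rw [show ((b : ℤ) - a + ((r + a : ℕ) : ℤ)) = ((r + b : ℕ) : ℤ) by push_cast; ring,
    intCoeff_natCast, pow_add, pow_add]
  field_simp

lemma tailSum_eq_add {F : PowerSeries ℂ} (hF : DiscSummable F) {x : ℂ} (hx : ‖x‖ < 1) (p : ℤ) :
    tailSum x F p = intCoeff F p + x * tailSum x F (p + 1) := by
  rw [tailSum, (summable_tailSum hF hx p).tsum_eq_zero_add, tailSum, ← tsum_mul_left]
  congr 1
  · simp
  · refine tsum_congr fun r => ?_
    rw [pow_succ', mul_assoc, show p + ((r + 1 : ℕ) : ℤ) = p + 1 + r by push_cast; ring]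

lemma tailSum_neg {F : PowerSeries ℂ} (hF : DiscSummable F) {x : ℂ} (hx : ‖x‖ < 1) (a : ℕ) :
    tailSum x F (-a) = x ^ a * evalAt F x := by
  induction a with
  | zero =>
    simp only [tailSum, evalAt, Nat.cast_zero, neg_zero, zero_add, intCoeff_natCast, pow_zero,
      one_mul]
    exact tsum_congr fun _ => mul_comm _ _
  | succ a ih =>
    rw [tailSum_eq_add hF hx, intCoeff_of_neg _ (by push_cast; omega),
      show -((a + 1 : ℕ) : ℤ) + 1 = -(a : ℤ) by push_cast; ring, ih, pow_succ]
    ring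

lemma sum_Icc_pow_sub_right_mul (t : ℂ) (f g : ℤ → ℂ) (h : ∀ p, f p = g p - t * g (p - 1)) (s : ℤ)
    (lo d : ℕ) : ∑ l ∈ Finset.Icc lo (lo + d), t ^ (lo + d - l) * f (l + s)
      = g ((lo + d : ℕ) + s) - t ^ (d + 1) * g (lo - 1 + s) := by
  induction d with
  | zero =>
    simp only [add_zero, Finset.Icc_self, Finset.sum_singleton, tsub_self, pow_zero, one_mul, h,
      zero_add, pow_one]
    rw [show (lo : ℤ) + s - 1 = lo - 1 + s by ring]
  | succ d ih =>
    rw [← add_assoc, Finset.sum_Icc_succ_top (by omega)]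
    have : ∀ l ∈ Finset.Icc lo (lo + d), t ^ (lo + d + 1 - l) * f (l + s)
        = t * (t ^ (lo + d - l) * f (l + s)) := fun l hl => by
      rw [Finset.mem_Icc] at hl
      rw [show lo + d + 1 - l = (lo + d - l) + 1 by omega, pow_succ]
      ring
    rw [Finset.sum_congr rfl this, ← Finset.mul_sum, ih, h,
      show ((lo + d + 1 : ℕ) : ℤ) + s - 1 = ((lo + d : ℕ) : ℤ) + s by push_cast; ring]
    simp
    ring

lemma sum_Icc_pow_sub_left_mul (t : ℂ) (f g : ℤ → ℂ) (h : ∀ p, f p = g p - t * g (p + 1)) (s : ℤ)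
    (lo d : ℕ) : ∑ l ∈ Finset.Icc lo (lo + d), t ^ (l - lo) * f (l + s)
      = g (lo + s) - t ^ (d + 1) * g ((lo + d : ℕ) + 1 + s) := by
  induction d with
  | zero =>
    simp only [add_zero, Finset.Icc_self, Finset.sum_singleton, tsub_self, pow_zero, one_mul, h,
      zero_add, pow_one]
    rw [show (lo : ℤ) + s + 1 = lo + 1 + s by ring]
  | succ d ih =>
    rw [← add_assoc, Finset.sum_Icc_succ_top (by omega), ih, h,
      show ((lo + d + 1 : ℕ) : ℤ) + s = ((lo + d : ℕ) : ℤ) + 1 + s by push_cast; ring,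
      show lo + d + 1 - lo = d + 1 by omega,
      show ((lo + d : ℕ) : ℤ) + 1 + s + 1 = ((lo + d + 1 : ℕ) : ℤ) + 1 + s by push_cast; ring]
    ring

/-! ### The determinants attached to a partition -/

/-- The polynomial `(1 - z)(1 - q z)`. -/
def quadPoly (q : ℂ) : PowerSeries ℂ := oneSubMulX 1 * oneSubMulX q

/-- The matrix with entries `[z^{ν_i - i + k}] ((1 - z)(1 - q z))^k F(z)`. -/
def partMatrix {m : ℕ} (q : ℂ) (F : PowerSeries ℂ) (ν : Fin m → ℕ) : Matrix (Fin m) (Fin m) ℂ :=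
  Matrix.of fun i k => intCoeff (quadPoly q ^ (k : ℕ) * F) (ν i + (-(i : ℤ) + k))

lemma constantCoeff_quadPoly (q : ℂ) : PowerSeries.constantCoeff (quadPoly q) = 1 := by
  simp [quadPoly, constantCoeff_oneSubMulX]

lemma discSummable_quadPoly (q : ℂ) : DiscSummable (quadPoly q) :=
  (discSummable_oneSubMulX 1).mul (discSummable_oneSubMulX q)

lemma evalAt_quadPoly (q : ℂ) {x : ℂ} (hx : ‖x‖ < 1) :
    evalAt (quadPoly q) x = (1 - x) * (1 - q * x) := by
  rw [quadPoly, evalAt_mul (discSummable_oneSubMulX 1) (discSummable_oneSubMulX q) hx,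
    evalAt_oneSubMulX, evalAt_oneSubMulX, one_mul]

lemma intCoeff_quadPoly_mul (q : ℂ) (F : PowerSeries ℂ) (p : ℤ) :
    intCoeff (quadPoly q * F) p
      = intCoeff F p - (1 + q) * intCoeff F (p - 1) + q * intCoeff F (p - 2) := by
  rw [quadPoly, mul_assoc, intCoeff_oneSubMulX_mul, intCoeff_oneSubMulX_mul,
    intCoeff_oneSubMulX_mul, show p - 1 - 1 = p - 2 by ring]
  ring

lemma Matrix.det_eq_of_forall_row_eq_sub_smul_succ {M : ℕ} {R : Type*} [CommRing R]
    {A B : Matrix (Fin (M + 1)) (Fin (M + 1)) R} (c : Fin M → R)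
    (hlast : ∀ j, B (Fin.last M) j = A (Fin.last M) j)
    (hcast : ∀ (i : Fin M) j, B i.castSucc j = A i.castSucc j - c i * A i.succ j) :
    B.det = A.det := by
  rw [← Matrix.det_submatrix_equiv_self Fin.revPerm A,
    ← Matrix.det_submatrix_equiv_self Fin.revPerm B]
  symm
  refine Matrix.det_eq_of_forall_row_eq_smul_add_pred (fun i => c i.rev) (fun j => ?_)
    fun i j => ?_
  · simp [hlast]
  · simp [Fin.rev_succ, Fin.rev_castSucc, hcast]

/-- The part following `μ i` (zero for the last index). -/
def nextPart {m : ℕ} (μ : Fin m → ℕ) (i : Fin m) : ℕ :=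
  if h : (i : ℕ) + 1 < m then μ ⟨i + 1, h⟩ else 0

/-- The finite set of all `κ` with `μ ≻ κ`. -/
def lowerInterlacers {m : ℕ} (μ : Fin m → ℕ) : Finset (Fin m → ℕ) :=
  Fintype.piFinset fun i => Finset.Icc (nextPart μ i) (μ i)

lemma mem_lowerInterlacers {m : ℕ} {μ κ : Fin m → ℕ} :
    κ ∈ lowerInterlacers μ ↔ Interlace μ κ := by
  simp only [lowerInterlacers, Fintype.mem_piFinset, Finset.mem_Icc, Interlace, nextPart]
  constructor
  · intro h
    refine ⟨fun i => (h i).2, fun i hi => ?_⟩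
    simpa [hi] using (h ⟨i, by omega⟩).1
  · rintro ⟨h1, h2⟩ i
    refine ⟨?_, h1 i⟩
    split_ifs with hi
    · exact h2 i hi
    · exact Nat.zero_le _

lemma nextPart_le {m : ℕ} {μ : Fin m → ℕ} (hμ : Antitone μ) (i : Fin m) : nextPart μ i ≤ μ i := by
  unfold nextPart
  split_ifs
  · exact hμ (by simp [Fin.le_def])
  · exact Nat.zero_le _

/-- Summing over all `κ ≺ μ` divides the power series by `1 - t z`. -/
lemma sum_lowerInterlacers_det {M : ℕ} (q t : ℂ) (G : PowerSeries ℂ) {μ : Fin (M + 1) → ℕ}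
    (hμ : Antitone μ) :
    ∑ κ ∈ lowerInterlacers μ, t ^ (∑ i, (μ i - κ i)) * (partMatrix q (oneSubMulX t * G) κ).det
      = (partMatrix q G μ).det := by
  have hrows := (Matrix.detRowAlternating (n := Fin (M + 1)) (R := ℂ)).toMultilinearMap.map_sum_finset
    (fun (i : Fin (M + 1)) (l : ℕ) (k : Fin (M + 1)) => t ^ (μ i - l) *
      intCoeff (quadPoly q ^ (k : ℕ) * (oneSubMulX t * G)) (l + (-(i : ℤ) + k)))
    (fun i => Finset.Icc (nextPart μ i) (μ i))
  have hterm : ∀ κ : Fin (M + 1) → ℕ,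
      t ^ (∑ i, (μ i - κ i)) * (partMatrix q (oneSubMulX t * G) κ).det
        = Matrix.det (Matrix.of fun i k => t ^ (μ i - κ i) *
          intCoeff (quadPoly q ^ (k : ℕ) * (oneSubMulX t * G)) (κ i + (-(i : ℤ) + k))) := by
    intro κ
    rw [← Finset.prod_pow_eq_pow_sum, ← Matrix.det_mul_column]
    rfl
  rw [Finset.sum_congr rfl fun κ _ => hterm κ]
  refine hrows.symm.trans ?_
  have hentry : ∀ i k : Fin (M + 1),
      ∑ l ∈ Finset.Icc (nextPart μ i) (μ i), t ^ (μ i - l) *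
        intCoeff (quadPoly q ^ (k : ℕ) * (oneSubMulX t * G)) (l + (-(i : ℤ) + k))
      = partMatrix q G μ i k - t ^ (μ i - nextPart μ i + 1) *
        intCoeff (quadPoly q ^ (k : ℕ) * G) (nextPart μ i - 1 + (-(i : ℤ) + k)) := by
    intro i k
    have h := sum_Icc_pow_sub_right_mul t (intCoeff (quadPoly q ^ (k : ℕ) * (oneSubMulX t * G)))
      (intCoeff (quadPoly q ^ (k : ℕ) * G))
      (fun p => by rw [mul_left_comm, intCoeff_oneSubMulX_mul]) (-(i : ℤ) + k)
      (nextPart μ i) (μ i - nextPart μ i)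
    rwa [Nat.add_sub_cancel' (nextPart_le hμ i)] at h
  refine Matrix.det_eq_of_forall_row_eq_sub_smul_succ
    (A := partMatrix q G μ)
    (fun i : Fin M => t ^ (μ i.castSucc - nextPart μ i.castSucc + 1)) (fun k => ?_) fun i k => ?_
  · rw [Finset.sum_apply, hentry, intCoeff_of_neg, mul_zero, sub_zero]
    have := k.is_lt
    simp [nextPart]
    omega
  · rw [Finset.sum_apply, hentry]
    congr 2
    simp only [partMatrix, Matrix.of_apply]
    congr 1
    have : nextPart μ i.castSucc = μ i.succ := by
      simp [nextPart, Fin.succ]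
    rw [this]
    simp
    ring

lemma det_partMatrix_eq_zero {M : ℕ} {q : ℂ} {F : PowerSeries ℂ} {j : ℕ}
    (hF : quadPoly q ^ j * F = 1) {ν : Fin (M + 1) → ℕ} (hj : j < M + 1)
    (hpos : ν ⟨j, hj⟩ ≠ 0) (hν : Antitone ν) (hlen : ∀ i : Fin (M + 1), j < i → ν i = 0) :
    (partMatrix q F ν).det = 0 := by
  refine Matrix.det_eq_zero_of_column_eq_zero ⟨j, hj⟩ fun i => ?_
  simp only [partMatrix, Matrix.of_apply, hF]
  have hne : (ν i : ℤ) + (-(i : ℤ) + j) ≠ 0 := by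
    rcases lt_or_ge j i with h | h
    · rw [hlen i h]
      push_cast
      omega
    · have : ν ⟨j, hj⟩ ≤ ν i := hν (by simpa [Fin.le_def] using h)
      omega
  rcases lt_or_gt_of_ne hne with h | h
  · exact intCoeff_of_neg _ h
  · obtain ⟨l, hl⟩ : ∃ l : ℕ, (ν i : ℤ) + (-(i : ℤ) + j) = (l + 1 : ℕ) :=
      ⟨((ν i : ℤ) + (-(i : ℤ) + j)).toNat - 1, by omega⟩
    rw [hl, intCoeff_natCast, PowerSeries.coeff_one]
    simp

lemma det_partMatrix_zero {M : ℕ} {q : ℂ} {F : PowerSeries ℂ}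
    (hF : PowerSeries.constantCoeff F = 1) :
    (partMatrix q F (fun _ : Fin (M + 1) => 0)).det = 1 := by
  rw [Matrix.det_of_isUpperTriangular]
  · refine Finset.prod_eq_one fun i _ => ?_
    simp [partMatrix, intCoeff_zero, hF, constantCoeff_quadPoly]
  · intro i k hik
    have : (k : ℕ) < i := hik
    simp only [partMatrix, Matrix.of_apply]
    exact intCoeff_of_neg _ (by push_cast; omega)

/-! ### Summing over larger partitions -/

lemma hasSum_sigma_of_fintype {β : Type*} {γ : β → Type*} [Fintype β] {f : (Σ b, γ b) → ℂ}
    {g : β → ℂ} (h : ∀ b, HasSum (fun r => f ⟨b, r⟩) (g b)) : HasSum f (∑ b, g b) := by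
  classical
  have key : ∀ b ∈ Finset.univ, HasSum (fun p : Σ b, γ b => if p.1 = b then f p else 0) (g b) := by
    intro b _
    refine (sigma_mk_injective (i := b)).hasSum_iff ?_ |>.1 ?_
    · rintro ⟨b', r⟩ hp
      refine if_neg fun hb => hp ?_
      simp only at hb
      subst hb
      exact ⟨r, rfl⟩
    · simpa [Function.comp_def] using h b
  refine (hasSum_sum key).congr_fun fun p => ?_
  simp

lemma hasSum_prod_of_fintype {β γ : Type*} [Fintype β] {f : β × γ → ℂ} {g : β → ℂ}
    (h : ∀ b, HasSum (fun r => f (b, r)) (g b)) : HasSum f (∑ b, g b) :=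
  (Equiv.sigmaEquivProd β γ).hasSum_iff.1 (hasSum_sigma_of_fintype h)

lemma hasSum_det_cons {M : ℕ} {ι : Type*} {v : ι → Fin (M + 1) → ℂ} {w : Fin (M + 1) → ℂ}
    (R : Fin M → Fin (M + 1) → ℂ) (h : ∀ k, HasSum (fun r => v r k) (w k)) :
    HasSum (fun r => Matrix.det (Matrix.of (Fin.cons (v r) R : Fin (M + 1) → Fin (M + 1) → ℂ)))
      (Matrix.det (Matrix.of (Fin.cons w R : Fin (M + 1) → Fin (M + 1) → ℂ))) := by
  obtain ⟨c, hc⟩ : ∃ c : Fin (M + 1) → ℂ, ∀ u : Fin (M + 1) → ℂ,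
      Matrix.det (Matrix.of (Fin.cons u R : Fin (M + 1) → Fin (M + 1) → ℂ)) = ∑ k, u k * c k := by
    refine ⟨fun k => (-1) ^ (k : ℕ) *
      (Matrix.of fun i j => R i (k.succAbove j) : Matrix (Fin M) (Fin M) ℂ).det, fun u => ?_⟩
    rw [Matrix.det_succ_row_zero]
    refine Finset.sum_congr rfl fun k _ => ?_
    have : (Matrix.of (Fin.cons u R : Fin (M + 1) → Fin (M + 1) → ℂ)).submatrix Fin.succ
        k.succAbove = Matrix.of fun i j => R i (k.succAbove j) := by
      ext i j
      simp
    rw [this, Matrix.of_apply, Fin.cons_zero]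
    ring
  simp only [hc]
  exact hasSum_sum fun k _ => (h k).mul_right (c k)

/-- The finite set of tails of partitions interlacing above `κ`. -/
def upperTails {M : ℕ} (κ : Fin (M + 1) → ℕ) : Finset (Fin M → ℕ) :=
  Fintype.piFinset fun i => Finset.Icc (κ i.succ) (κ i.castSucc)

lemma interlace_cons_iff {M : ℕ} {κ : Fin (M + 1) → ℕ} {a : ℕ} {τ : Fin M → ℕ} :
    Interlace (Fin.cons a τ : Fin (M + 1) → ℕ) κ ↔ κ 0 ≤ a ∧ τ ∈ upperTails κ := by
  simp only [Interlace, upperTails, Fintype.mem_piFinset, Finset.mem_Icc]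
  constructor
  · rintro ⟨h1, h2⟩
    refine ⟨h1 0, fun i => ⟨by simpa using h1 i.succ, ?_⟩⟩
    exact h2 i (by omega)
  · rintro ⟨h1, h2⟩
    refine ⟨fun i => ?_, fun i hi => ?_⟩
    · refine Fin.cases h1 (fun i => ?_) i
      simpa using (h2 i).1
    · exact (h2 ⟨i, by omega⟩).2

/-- Partitions interlacing above `κ`, parametrized by their tail and their first part. -/
def upperEquiv {M : ℕ} (κ : Fin (M + 1) → ℕ) :
    upperTails κ × ℕ ≃ {l : Fin (M + 1) → ℕ // Interlace l κ} where
  toFun p := ⟨Fin.cons (κ 0 + p.2) p.1.1, interlace_cons_iff.2 ⟨Nat.le_add_right _ _, p.1.2⟩⟩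
  invFun l := (⟨Fin.tail l.1, (interlace_cons_iff.1 (by
    rw [Fin.cons_self_tail]; exact l.2 : Interlace (Fin.cons (l.1 0) (Fin.tail l.1)) κ)).2⟩,
    l.1 0 - κ 0)
  left_inv p := by simp
  right_inv l := by
    have : κ 0 + (l.1 0 - κ 0) = l.1 0 := Nat.add_sub_cancel' (l.2.1 0)
    simp [this]

/-- The matrix with entries `∑_r x^r [z^{ν_i - i + k + r}] ((1 - z)(1 - q z))^k F(z)`. -/
def tailMatrix {m : ℕ} (q x : ℂ) (F : PowerSeries ℂ) (ν : Fin m → ℕ) : Matrix (Fin m) (Fin m) ℂ :=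
  Matrix.of fun i k => tailSum x (quadPoly q ^ (k : ℕ) * F) (ν i + (-(i : ℤ) + k))

lemma hasSum_upper_tailMatrix {M : ℕ} (q : ℂ) {x : ℂ} (hx : ‖x‖ < 1) {F : PowerSeries ℂ}
    (hF : DiscSummable F) {κ : Fin (M + 1) → ℕ} (hκ : Antitone κ) :
    HasSum (fun l : {l : Fin (M + 1) → ℕ // Interlace l κ} =>
      x ^ (∑ i, (l.1 i - κ i)) * (partMatrix q F l.1).det) (tailMatrix q x F κ).det := by
  have hFk : ∀ k : ℕ, DiscSummable (quadPoly q ^ k * F) :=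
    fun k => ((discSummable_quadPoly q).pow k).mul hF
  set row : (i : Fin M) → ℕ → Fin (M + 1) → ℂ := fun i l k => x ^ (l - κ i.succ) *
    intCoeff (quadPoly q ^ (k : ℕ) * F) (l + (-((i : ℕ) + 1 : ℤ) + k)) with hrow
  have hterm : ∀ (τ : upperTails κ) (r : ℕ),
      x ^ (∑ i, ((upperEquiv κ (τ, r)).1 i - κ i)) * (partMatrix q F (upperEquiv κ (τ, r)).1).det
        = Matrix.det (Matrix.of (Fin.cons
          (fun k : Fin (M + 1) => x ^ r * intCoeff (quadPoly q ^ (k : ℕ) * F) (κ 0 + k + r))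
          (fun i => row i (τ.1 i)) : Fin (M + 1) → Fin (M + 1) → ℂ)) := by
    intro τ r
    rw [← Finset.prod_pow_eq_pow_sum, ← Matrix.det_mul_column]
    congr 1
    ext i k
    refine Fin.cases ?_ (fun i => ?_) i
    · simp [upperEquiv, partMatrix]
      left
      congr 1
      ring
    · simp [upperEquiv, partMatrix, hrow]
  rw [← (upperEquiv κ).hasSum_iff]
  have hfin : HasSum _ _ := hasSum_prod_of_fintype
    (f := fun p : upperTails κ × ℕ => x ^ (∑ i, ((upperEquiv κ p).1 i - κ i)) *
      (partMatrix q F (upperEquiv κ p).1).det)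
    (g := fun τ => Matrix.det (Matrix.of (Fin.cons (tailMatrix q x F κ 0)
          (fun i => row i (τ.1 i)) : Fin (M + 1) → Fin (M + 1) → ℂ))) fun τ => by
      simp only [hterm]
      refine hasSum_det_cons _ fun k => ?_
      simp only [tailMatrix, Matrix.of_apply]
      have h := (summable_tailSum (hFk k) hx (κ 0 + (-((0 : Fin (M + 1)) : ℤ) + k))).hasSum
      simpa [tailSum] using h
  refine (congrArg (HasSum _) ?_).mpr hfin
  rw [Finset.univ_eq_attach, Finset.sum_attach (upperTails κ) (fun τ => Matrix.det (Matrix.of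
    (Fin.cons (tailMatrix q x F κ 0) (fun i => row i (τ i)) : Fin (M + 1) → Fin (M + 1) → ℂ)))]
  have hmul := ((Matrix.detRowAlternating (n := Fin (M + 1))
    (R := ℂ)).toMultilinearMap.curryLeft (tailMatrix q x F κ 0)).map_sum_finset row
      fun i => Finset.Icc (κ i.succ) (κ i.castSucc)
  refine Eq.trans ?_ hmul
  refine Matrix.det_eq_of_forall_row_eq_smul_add_pred
    (fun i : Fin M => x ^ (κ i.castSucc - κ i.succ + 1)) (fun k => rfl) fun i k => ?_
  have h := sum_Icc_pow_sub_left_mul x (intCoeff (quadPoly q ^ (k : ℕ) * F))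
    (tailSum x (quadPoly q ^ (k : ℕ) * F))
    (fun p => by rw [tailSum_eq_add (hFk k) hx p]; ring) (-((i : ℕ) + 1 : ℤ) + k)
    (κ i.succ) (κ i.castSucc - κ i.succ)
  rw [Nat.add_sub_cancel' (hκ (Fin.castSucc_lt_succ (i := i)).le)] at h
  simp only [Fin.cons_succ, Finset.sum_apply, hrow, h, tailMatrix, Matrix.of_apply,
    Fin.val_succ, Fin.val_castSucc]
  rw [show (κ i.castSucc : ℤ) + 1 + (-((i : ℕ) + 1 : ℤ) + (k : ℕ))
    = κ i.castSucc + (-((i : ℕ) : ℤ) + (k : ℕ)) by ring]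
  push_cast
  ring

lemma evalAt_mul_tailSum_sub {q x : ℂ} (hx : ‖x‖ < 1) {G : PowerSeries ℂ} (hG : DiscSummable G)
    (s : ℤ) : evalAt (quadPoly q) x * tailSum x G s - x * tailSum x (quadPoly q * G) (s + 1)
      = intCoeff (oneSubMulX (q * x) * G) s := by
  have hG' := (discSummable_oneSubMulX (q * x)).mul hG
  have h1 := tailSum_eq_add hG' hx s
  rw [← sub_eq_iff_eq_add] at h1
  rw [← h1]
  simp only [tailSum, ← tsum_mul_left]
  have hs1 := (summable_tailSum hG hx s).mul_left (evalAt (quadPoly q) x)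
  have hs2 := (summable_tailSum ((discSummable_quadPoly q).mul hG) hx (s + 1)).mul_left x
  have hs3 := (summable_tailSum hG' hx (s + 1)).mul_left x
  rw [← hs1.tsum_sub hs2, ← (summable_tailSum hG' hx s).tsum_sub hs3]
  refine tsum_congr fun r => ?_
  rw [evalAt_quadPoly q hx, intCoeff_quadPoly_mul, intCoeff_oneSubMulX_mul,
    intCoeff_oneSubMulX_mul, show s + 1 + (r : ℤ) - 1 = s + r by ring,
    show s + 1 + (r : ℤ) - 2 = s + r - 1 by ring]
  ring

lemma det_tailMatrix {M : ℕ} {q x : ℂ} (hq : ‖q‖ < 1) (hx : ‖x‖ < 1) {F : PowerSeries ℂ}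
    (hF : DiscSummable F) (hF0 : PowerSeries.constantCoeff F = 1) {κ : Fin (M + 1) → ℕ}
    (hκ : κ (Fin.last M) = 0) :
    (tailMatrix q x F κ).det = evalAt F x * (partMatrix q (oneSubMulX (q * x) * F) κ).det := by
  have hFk : ∀ k : ℕ, DiscSummable (quadPoly q ^ k * F) :=
    fun k => ((discSummable_quadPoly q).pow k).mul hF
  set e := evalAt (quadPoly q) x with he
  have he0 : e ≠ 0 := by
    rw [he, evalAt_quadPoly q hx]
    refine mul_ne_zero (fun h => ?_) (fun h => ?_)
    · rw [← sub_eq_zero.1 h, norm_one] at hx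
      exact lt_irrefl _ hx
    · have : ‖q * x‖ = 1 := by rw [← sub_eq_zero.1 h, norm_one]
      rw [norm_mul] at this
      nlinarith [norm_nonneg q, norm_nonneg x]
  set N := partMatrix q (oneSubMulX (q * x) * F) κ with hN
  have hcol : ∀ (i : Fin (M + 1)) (k : Fin M), e * tailMatrix q x F κ i k.castSucc
      - x * tailMatrix q x F κ i k.succ = N i k.castSucc := by
    intro i k
    have h := evalAt_mul_tailSum_sub (q := q) hx (hFk k) (κ i + (-(i : ℤ) + k))
    simp only [tailMatrix, hN, partMatrix, Matrix.of_apply, Fin.val_castSucc, Fin.val_succ]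
    rw [mul_left_comm, ← h, pow_succ', mul_assoc, ← he]
    push_cast
    rw [show (κ i : ℤ) + (-(i : ℤ) + k) + 1 = κ i + (-(i : ℤ) + (k + 1)) by ring]
  set B : Matrix (Fin (M + 1)) (Fin (M + 1)) ℂ := Matrix.of fun i k =>
    Fin.lastCases (motive := fun _ => ℂ) (tailMatrix q x F κ i (Fin.last M))
      (fun k => e⁻¹ * N i k.castSucc) k with hB
  have hdetB : B.det = (tailMatrix q x F κ).det := by
    rw [← Matrix.det_transpose, ← Matrix.det_transpose (tailMatrix q x F κ)]
    refine Matrix.det_eq_of_forall_row_eq_sub_smul_succ (fun _ => e⁻¹ * x) (fun i => ?_)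
      fun k i => ?_
    · simp [hB]
    · simp only [hB, Matrix.transpose_apply, Matrix.of_apply, Fin.lastCases_castSucc, ← hcol]
      field_simp
  have hNlast : ∀ k : Fin M, N (Fin.last M) k.castSucc = 0 := fun k => by
    simp only [hN, partMatrix, Matrix.of_apply, hκ]
    refine intCoeff_of_neg _ ?_
    simp
  have hNll : N (Fin.last M) (Fin.last M) = 1 := by
    simp [hN, partMatrix, hκ, intCoeff_zero, hF0, constantCoeff_quadPoly,
      constantCoeff_oneSubMulX]
  have hBll : B (Fin.last M) (Fin.last M) = e ^ M * evalAt F x := by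
    have h := tailSum_neg (hFk M) hx 0
    rw [evalAt_mul ((discSummable_quadPoly q).pow M) hF hx,
      evalAt_pow (discSummable_quadPoly q) hx] at h
    simpa [hB, tailMatrix, hκ] using h
  have hexp : ∀ A : Matrix (Fin (M + 1)) (Fin (M + 1)) ℂ,
      (∀ k : Fin M, A (Fin.last M) k.castSucc = 0) → A.det = A (Fin.last M) (Fin.last M) *
        (A.submatrix (Fin.castSucc : Fin M → _) (Fin.castSucc : Fin M → _)).det := by
    intro A hA
    rw [Matrix.det_succ_row A (Fin.last M), Fin.sum_univ_castSucc]
    simp [hA, Fin.succAbove_last, ← two_mul]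
  rw [← hdetB, hexp B fun k => by simp [hB, hNlast], hexp N hNlast, hBll, hNll]
  have hsub : (B.submatrix (Fin.castSucc : Fin M → _) (Fin.castSucc : Fin M → _))
      = e⁻¹ • N.submatrix (Fin.castSucc : Fin M → _) (Fin.castSucc : Fin M → _) := by
    ext i k
    simp [hB]
  rw [hsub, Matrix.det_smul, Fintype.card_fin, inv_pow]
  field_simp

/-- Summing over all `l ≻ κ`, where the last part of `κ` vanishes. -/
lemma hasSum_upper {M : ℕ} {q x : ℂ} (hq : ‖q‖ < 1) (hx : ‖x‖ < 1) {F : PowerSeries ℂ}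
    (hF : DiscSummable F) (hF0 : PowerSeries.constantCoeff F = 1) {κ : Fin (M + 1) → ℕ}
    (hanti : Antitone κ) (hκ : κ (Fin.last M) = 0) :
    HasSum (fun l : {l : Fin (M + 1) → ℕ // Interlace l κ} =>
      x ^ (∑ i, (l.1 i - κ i)) * (partMatrix q F l.1).det)
      (evalAt F x * (partMatrix q (oneSubMulX (q * x) * F) κ).det) := by
  rw [← det_tailMatrix hq hx hF hF0 hκ]
  exact hasSum_upper_tailMatrix q hx hF hanti

/-! ### Interlacing chains -/

lemma Interlace.antitone_left {M : ℕ} {a b : Fin (M + 1) → ℕ} (h : Interlace a b) :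
    Antitone a :=
  Fin.antitone_iff_succ_le.2 fun i =>
    (h.2 i (by omega)).trans (h.1 i.castSucc)

lemma Interlace.antitone_right {M : ℕ} {a b : Fin (M + 1) → ℕ} (h : Interlace a b) :
    Antitone b :=
  Fin.antitone_iff_succ_le.2 fun i =>
    (h.1 i.succ).trans (h.2 i (by omega))

/-- Chains `∅ = ν̄⁽⁰⁾ ≺ μ⁽¹⁾ ≺ ν̄⁽¹⁾ ≺ ⋯ ≺ μ⁽ʲ⁾ ≺ ν̄⁽ʲ⁾ = ν` with `ℓ(ν̄⁽ᵏ⁾) ≤ k`. -/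
def RightChain {m : ℕ} (j : ℕ) (ν : Fin m → ℕ) : Type :=
  {p : (Fin j → Fin m → ℕ) × (Fin (j + 1) → Fin m → ℕ) //
    p.2 0 = (fun _ => 0) ∧ p.2 (Fin.last j) = ν ∧
    (∀ k : Fin j, Interlace (p.2 k.succ) (p.1 k)) ∧
    (∀ k : Fin j, Interlace (p.1 k) (p.2 k.castSucc)) ∧
    (∀ k : Fin (j + 1), ∀ i : Fin m, (k : ℕ) ≤ (i : ℕ) → p.2 k i = 0)}

/-- The pairs `(μ, κ)` with `ν ≻ μ ≻ κ`. -/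
def lowerPairs {m : ℕ} (ν : Fin m → ℕ) : Finset (Σ _ : Fin m → ℕ, Fin m → ℕ) :=
  (lowerInterlacers ν).sigma fun μ => lowerInterlacers μ

lemma mem_lowerPairs {m : ℕ} {ν : Fin m → ℕ} {s : Σ _ : Fin m → ℕ, Fin m → ℕ} :
    s ∈ lowerPairs ν ↔ Interlace ν s.1 ∧ Interlace s.1 s.2 := by
  simp [lowerPairs, mem_lowerInterlacers]

/-- Extend a right chain by one more pair of partitions. -/
def RightChain.extend {m j : ℕ} {ν : Fin m → ℕ} (hν : ∀ i : Fin m, j + 1 ≤ (i : ℕ) → ν i = 0)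
    (p : Σ s : lowerPairs ν, RightChain j s.1.2) : RightChain (j + 1) ν :=
  ⟨(Fin.snoc (α := fun _ => Fin m → ℕ) p.2.1.1 p.1.1.1,
      Fin.snoc (α := fun _ => Fin m → ℕ) p.2.1.2 ν), by
    obtain ⟨⟨s, hs⟩, ⟨r1, r2⟩, h0, hlast, hup, hdown, hlen⟩ := p
    rw [mem_lowerPairs] at hs
    simp only at h0 hlast hup hdown hlen ⊢
    refine ⟨?_, by simp, fun k => ?_, fun k => ?_, fun k => ?_⟩
    · rw [← Fin.castSucc_zero, Fin.snoc_castSucc, h0]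
    · refine Fin.lastCases ?_ (fun k => ?_) k
      · rw [Fin.succ_last, Fin.snoc_last, Fin.snoc_last]
        exact hs.1
      · rw [Fin.succ_castSucc, Fin.snoc_castSucc, Fin.snoc_castSucc]
        exact hup k
    · refine Fin.lastCases ?_ (fun k => ?_) k
      · rw [Fin.snoc_castSucc, Fin.snoc_last, hlast]
        exact hs.2
      · rw [Fin.snoc_castSucc, Fin.snoc_castSucc]
        exact hdown k
    · refine Fin.lastCases ?_ (fun k => ?_) k
      · simpa using hν
      · simpa using hlen k⟩

lemma RightChain.extend_bijective {m j : ℕ} {ν : Fin m → ℕ}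
    (hν : ∀ i : Fin m, j + 1 ≤ (i : ℕ) → ν i = 0) :
    Function.Bijective (RightChain.extend hν) := by
  constructor
  · rintro ⟨⟨⟨μ, κ⟩, hs⟩, ⟨⟨r1, r2⟩, hr⟩⟩ ⟨⟨⟨μ', κ'⟩, hs'⟩, ⟨⟨r1', r2'⟩, hr'⟩⟩ h
    have h1 : Fin.snoc (α := fun _ => Fin m → ℕ) r1 μ = Fin.snoc (α := fun _ => Fin m → ℕ) r1' μ' :=
      congrArg (fun p => p.1.1) h
    have h2 : Fin.snoc (α := fun _ => Fin m → ℕ) r2 ν = Fin.snoc (α := fun _ => Fin m → ℕ) r2' ν :=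
      congrArg (fun p => p.1.2) h
    obtain ⟨h1, hμ⟩ := Fin.snoc_inj.1 h1
    obtain ⟨h2, -⟩ := Fin.snoc_inj.1 h2
    subst h1 hμ h2
    obtain rfl : κ = κ' := hr.2.1.symm.trans hr'.2.1
    rfl
  · rintro ⟨⟨p1, p2⟩, h0, hlast, hup, hdown, hlen⟩
    refine ⟨⟨⟨⟨p1 (Fin.last j), p2 (Fin.last j).castSucc⟩, mem_lowerPairs.2 ⟨?_, hdown _⟩⟩,
      ⟨(Fin.init p1, Fin.init p2), h0, rfl, fun k => ?_, fun k => hdown k.castSucc,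
        fun k i hki => hlen k.castSucc i hki⟩⟩, Subtype.ext (Prod.ext ?_ ?_)⟩
    · have := hup (Fin.last j)
      rwa [Fin.succ_last, hlast] at this
    · have := hup k.castSucc
      rwa [Fin.succ_castSucc] at this
    · exact Fin.snoc_init_self p1
    · exact (congrArg (Fin.snoc (α := fun _ => Fin m → ℕ) (Fin.init p2)) hlast.symm).trans
        (Fin.snoc_init_self p2)

/-- The series `1 / ((1 - z)(1 - q z))`. -/
def invQuadPoly (q : ℂ) : PowerSeries ℂ := geomPowerSeries 1 * geomPowerSeries q

lemma quadPoly_mul_invQuadPoly (q : ℂ) : quadPoly q * invQuadPoly q = 1 := by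
  rw [quadPoly, invQuadPoly, mul_mul_mul_comm, oneSubMulX_mul_geomPowerSeries,
    oneSubMulX_mul_geomPowerSeries, one_mul]

lemma constantCoeff_invQuadPoly (q : ℂ) : PowerSeries.constantCoeff (invQuadPoly q) = 1 := by
  simp [invQuadPoly, constantCoeff_geomPowerSeries]

/-- The exponent contributed by a right chain. -/
def RightChain.weight {m j : ℕ} {ν : Fin m → ℕ} (p : RightChain j ν) : ℕ :=
  ∑ k : Fin j, ∑ i, (p.1.1 k i - p.1.2 k.castSucc i)

lemma RightChain.weight_extend {m j : ℕ} {ν : Fin m → ℕ}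
    (hν : ∀ i : Fin m, j + 1 ≤ (i : ℕ) → ν i = 0) (s : lowerPairs ν) (r : RightChain j s.1.2) :
    (RightChain.extend hν ⟨s, r⟩).weight = r.weight + ∑ i, (s.1.1 i - s.1.2 i) := by
  have hlast := r.2.2.1
  simp [RightChain.weight, RightChain.extend, Fin.sum_univ_castSucc, hlast]

lemma sum_lowerPairs_det {M : ℕ} (q : ℂ) (j : ℕ) {ν : Fin (M + 1) → ℕ} (hν : Antitone ν) :
    ∑ s ∈ lowerPairs ν, q ^ (∑ i, (s.1 i - s.2 i)) * (partMatrix q (invQuadPoly q ^ j) s.2).det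
      = (partMatrix q (invQuadPoly q ^ (j + 1)) ν).det := by
  have hF1 : invQuadPoly q ^ j = oneSubMulX q * (geomPowerSeries q * invQuadPoly q ^ j) := by
    rw [← mul_assoc, oneSubMulX_mul_geomPowerSeries, one_mul]
  have hF2 : geomPowerSeries q * invQuadPoly q ^ j = oneSubMulX 1 * invQuadPoly q ^ (j + 1) := by
    rw [pow_succ', ← mul_assoc (oneSubMulX 1)]
    congr 1
    rw [invQuadPoly, ← mul_assoc, oneSubMulX_mul_geomPowerSeries, one_mul]
  rw [lowerPairs, Finset.sum_sigma, ← sum_lowerInterlacers_det q 1 _ hν]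
  refine Finset.sum_congr rfl fun μ hμ => ?_
  rw [← hF2, one_pow, one_mul,
    ← sum_lowerInterlacers_det q q _ (mem_lowerInterlacers.1 hμ).antitone_right, ← hF1]

lemma hasSum_rightChain_succ {M : ℕ} {q : ℂ} {j : ℕ} {ν : Fin (M + 1) → ℕ} (hν : Antitone ν)
    (hlen : ∀ i : Fin (M + 1), j + 1 ≤ (i : ℕ) → ν i = 0)
    (ih : ∀ κ : Fin (M + 1) → ℕ, Antitone κ → (∀ i : Fin (M + 1), j + 1 ≤ (i : ℕ) → κ i = 0) →
      HasSum (fun p : RightChain j κ => q ^ p.weight)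
        (partMatrix q (invQuadPoly q ^ j) κ).det) :
    HasSum (fun p : RightChain (j + 1) ν => q ^ p.weight)
      (partMatrix q (invQuadPoly q ^ (j + 1)) ν).det := by
  have hfib : ∀ s : lowerPairs ν, HasSum
      (fun r : RightChain j s.1.2 => q ^ (RightChain.extend hlen ⟨s, r⟩).weight)
      (q ^ (∑ i, (s.1.1 i - s.1.2 i)) * (partMatrix q (invQuadPoly q ^ j) s.1.2).det) := by
    intro s
    have hs := mem_lowerPairs.1 s.2
    refine ((ih s.1.2 hs.2.antitone_right fun i hi => Nat.le_zero.1
      (hlen i hi ▸ (hs.2.1 i).trans (hs.1.1 i))).mul_left _).congr_fun fun r => ?_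
    rw [RightChain.weight_extend, pow_add, mul_comm]
  have hsum := hasSum_sigma_of_fintype
    (f := fun p => q ^ (RightChain.extend hlen p).weight) hfib
  rw [Finset.univ_eq_attach, Finset.sum_attach (lowerPairs ν) (fun s =>
    q ^ (∑ i, (s.1 i - s.2 i)) * (partMatrix q (invQuadPoly q ^ j) s.2).det),
    sum_lowerPairs_det q j hν] at hsum
  exact (Equiv.ofBijective _ (RightChain.extend_bijective hlen)).hasSum_iff.1 hsum

lemma hasSum_rightChain {M : ℕ} (q : ℂ) (j : ℕ) : ∀ {ν : Fin (M + 1) → ℕ}, Antitone ν →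
    (∀ i : Fin (M + 1), j + 1 ≤ (i : ℕ) → ν i = 0) →
    HasSum (fun p : RightChain j ν => q ^ p.weight)
      (partMatrix q (invQuadPoly q ^ j) ν).det := by
  induction j with
  | zero =>
    intro ν hν hlen
    by_cases h0 : ν 0 = 0
    · obtain rfl : ν = fun _ => 0 := by
        funext i
        exact Nat.le_zero.1 (h0 ▸ hν (Fin.zero_le i))
      let p0 : RightChain 0 (fun _ : Fin (M + 1) => 0) :=
        ⟨(Fin.elim0, fun _ _ => 0), rfl, rfl, fun k => k.elim0, fun k => k.elim0, fun _ _ _ => rfl⟩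
      have hsub : ∀ p : RightChain 0 (fun _ : Fin (M + 1) => 0), p = p0 := by
        rintro ⟨⟨p1, p2⟩, h⟩
        refine Subtype.ext (Prod.ext (Subsingleton.elim _ _) ?_)
        funext k
        obtain rfl : k = 0 := Fin.ext (by omega)
        exact h.1
      rw [det_partMatrix_zero (by simp)]
      convert hasSum_single p0 fun p hp => absurd (hsub p) hp
      simp [RightChain.weight]
    · have : IsEmpty (RightChain 0 ν) := ⟨fun p => h0 <| by
        rw [← p.2.2.1]
        exact p.2.2.2.2.2 (Fin.last 0) 0 le_rfl⟩
      rw [det_partMatrix_eq_zero (j := 0) (by simp) (Nat.succ_pos M) h0 hν fun i hi => hlen i hi]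
      exact hasSum_empty
  | succ j ih =>
    intro ν hν hlen
    by_cases h0 : ∀ h : j + 1 < M + 1, ν ⟨j + 1, h⟩ = 0
    · have hlen' : ∀ i : Fin (M + 1), j + 1 ≤ (i : ℕ) → ν i = 0 := by
        intro i hi
        rcases hi.eq_or_lt with h | h
        · have hi' : i = ⟨j + 1, h ▸ i.2⟩ := Fin.ext h.symm
          rw [hi']
          exact h0 _
        · exact hlen i h
      exact hasSum_rightChain_succ hν hlen' fun s hs hs' => ih hs hs'
    · push Not at h0
      obtain ⟨hj, hpos⟩ := h0
      have : IsEmpty (RightChain (j + 1) ν) := ⟨fun p => hpos <| by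
        rw [← p.2.2.1]
        exact p.2.2.2.2.2 (Fin.last (j + 1)) ⟨j + 1, hj⟩ le_rfl⟩
      rw [det_partMatrix_eq_zero (j := j + 1)
        (by rw [← mul_pow, quadPoly_mul_invQuadPoly, one_pow]) hj hpos hν fun i hi => hlen i hi]
      exact hasSum_empty

/-! ### Left chains -/

/-- Chains `∅ = λ⁽⁰⁾ ≺ λ⁽¹⁾ ≺ ⋯ ≺ λ⁽ᵏ⁾`. -/
def LeftChain (m k : ℕ) : Type :=
  {c : Fin (k + 1) → Fin m → ℕ //
    c 0 = (fun _ => 0) ∧ ∀ i : Fin k, Interlace (c i.succ) (c i.castSucc)}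

lemma LeftChain.eq_zero {m k : ℕ} (c : LeftChain m k) (i : Fin (k + 1)) :
    ∀ l : Fin m, (i : ℕ) ≤ (l : ℕ) → c.1 i l = 0 := by
  induction i using Fin.induction with
  | zero => exact fun l _ => by rw [c.2.1]
  | succ i ih =>
    rintro ⟨l, hl⟩ hil
    obtain ⟨l, rfl⟩ : ∃ l', l = l' + 1 := ⟨l - 1, by simp at hil; omega⟩
    refine Nat.le_zero.1 (((c.2.2 i).2 l hl).trans (ih _ ?_).le)
    simpa using hil

lemma LeftChain.antitone {M k : ℕ} (c : LeftChain (M + 1) k) (i : Fin (k + 1)) :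
    Antitone (c.1 i) := by
  refine Fin.cases ?_ (fun i => (c.2.2 i).antitone_left) i
  rw [c.2.1]
  exact antitone_const

/-- Extend a left chain by one more partition. -/
def LeftChain.extend {m k : ℕ}
    (p : Σ c : LeftChain m k, {l : Fin m → ℕ // Interlace l (c.1 (Fin.last k))}) :
    LeftChain m (k + 1) :=
  ⟨Fin.snoc (α := fun _ => Fin m → ℕ) p.1.1 p.2.1, by
    obtain ⟨⟨c, h0, hc⟩, l, hl⟩ := p
    refine ⟨?_, fun i => ?_⟩
    · exact (Fin.snoc_castSucc (α := fun _ => Fin m → ℕ) l c 0).trans h0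
    · refine Fin.lastCases ?_ (fun i => ?_) i
      · rw [Fin.succ_last, Fin.snoc_last, Fin.snoc_castSucc]
        exact hl
      · rw [Fin.succ_castSucc, Fin.snoc_castSucc, Fin.snoc_castSucc]
        exact hc i⟩

lemma LeftChain.extend_bijective {m k : ℕ} :
    Function.Bijective (LeftChain.extend (m := m) (k := k)) := by
  constructor
  · rintro ⟨⟨c, hc⟩, l, hl⟩ ⟨⟨c', hc'⟩, l', hl'⟩ h
    have h1 : Fin.snoc (α := fun _ => Fin m → ℕ) c l = Fin.snoc (α := fun _ => Fin m → ℕ) c' l' :=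
      congrArg (fun p => p.1) h
    obtain ⟨rfl, rfl⟩ := Fin.snoc_inj.1 h1
    rfl
  · rintro ⟨c, h0, hc⟩
    refine ⟨⟨⟨Fin.init c, h0, fun i => ?_⟩, c (Fin.last (k + 1)), ?_⟩,
      Subtype.ext (Fin.snoc_init_self c)⟩
    · have := hc i.castSucc
      rwa [Fin.succ_castSucc] at this
    · have := hc (Fin.last k)
      rwa [Fin.succ_last] at this

/-- The total weight of a left chain, its last partition excepted. -/
def LeftChain.weight {m k : ℕ} (c : LeftChain m k) : ℕ := ∑ i : Fin k, wt (c.1 i.castSucc)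

lemma LeftChain.weight_extend {m k : ℕ} (c : LeftChain m k)
    (l : {l : Fin m → ℕ // Interlace l (c.1 (Fin.last k))}) :
    (LeftChain.extend ⟨c, l⟩).weight = c.weight + wt (c.1 (Fin.last k)) := by
  simp [LeftChain.weight, LeftChain.extend, Fin.sum_univ_castSucc]

lemma LeftChain.extend_last {m k : ℕ} (c : LeftChain m k)
    (l : {l : Fin m → ℕ // Interlace l (c.1 (Fin.last k))}) :
    (LeftChain.extend ⟨c, l⟩).1 (Fin.last (k + 1)) = l.1 := by
  simp [LeftChain.extend]

lemma Interlace.wt_eq {m : ℕ} {a b : Fin m → ℕ} (h : Interlace a b) :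
    wt a = wt b + ∑ i, (a i - b i) := by
  rw [wt, wt, ← Finset.sum_add_distrib]
  exact Finset.sum_congr rfl fun i _ => (Nat.add_sub_cancel' (h.1 i)).symm

/-- The summand attached to a left chain. -/
def LeftChain.term {m k : ℕ} (q : ℂ) (s : ℕ) (F : PowerSeries ℂ) (c : LeftChain m k) : ℂ :=
  q ^ c.weight * (q ^ s) ^ wt (c.1 (Fin.last k)) * (partMatrix q F (c.1 (Fin.last k))).det

lemma LeftChain.hasSum_term_extend {M k s : ℕ} (hk : k ≤ M) (hs : s ≠ 0) {q : ℂ} (hq : ‖q‖ < 1)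
    {F : PowerSeries ℂ} (hF : DiscSummable F) (hF0 : PowerSeries.constantCoeff F = 1)
    (c : LeftChain (M + 1) k) :
    HasSum (fun l : {l : Fin (M + 1) → ℕ // Interlace l (c.1 (Fin.last k))} =>
        (LeftChain.extend ⟨c, l⟩).term q s F)
      (evalAt F (q ^ s) * c.term q (s + 1) (oneSubMulX (q * q ^ s) * F)) := by
  have hx : ‖q ^ s‖ < 1 := by
    rw [norm_pow]
    exact pow_lt_one₀ (norm_nonneg q) hq hs
  have h := (hasSum_upper hq hx hF hF0 (c.antitone (Fin.last k))
    (c.eq_zero (Fin.last k) (Fin.last M) hk)).mul_left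
    (q ^ (c.weight + wt (c.1 (Fin.last k))) * (q ^ s) ^ wt (c.1 (Fin.last k)))
  have hval : evalAt F (q ^ s) * c.term q (s + 1) (oneSubMulX (q * q ^ s) * F) =
      q ^ (c.weight + wt (c.1 (Fin.last k))) * (q ^ s) ^ wt (c.1 (Fin.last k)) *
      (evalAt F (q ^ s) *
        (partMatrix q (oneSubMulX (q * q ^ s) * F) (c.1 (Fin.last k))).det) := by
    rw [LeftChain.term, pow_succ q s, mul_pow, pow_add]
    ring
  rw [hval]
  refine h.congr_fun fun l => ?_
  rw [LeftChain.term, LeftChain.extend_last, LeftChain.weight_extend, l.2.wt_eq, pow_add (q ^ s)]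
  ring

lemma LeftChain.hasSum_term {M : ℕ} {q : ℂ} (hq : ‖q‖ < 1) (k : ℕ) :
    ∀ (s : ℕ) {F : PowerSeries ℂ}, k ≤ M + 1 → s ≠ 0 → DiscSummable F →
      PowerSeries.constantCoeff F = 1 →
      Summable (fun c : LeftChain (M + 1) k => c.term q s F) →
      HasSum (fun c : LeftChain (M + 1) k => c.term q s F)
        ((∏ i : Fin k, evalAt F (q ^ (s + (i : ℕ)))) *
          ∏ i : Fin k, ∏ j ∈ Finset.Ioi i, (1 - q * q ^ (s + (i : ℕ)) * q ^ (s + (j : ℕ)))) := by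
  induction k with
  | zero =>
    intro s F _ _ _ hF0 _
    let c0 : LeftChain (M + 1) 0 := ⟨fun _ _ => 0, rfl, fun i => i.elim0⟩
    have hsub : ∀ c : LeftChain (M + 1) 0, c = c0 := by
      rintro ⟨c, h⟩
      refine Subtype.ext (funext fun i => ?_)
      obtain rfl : i = 0 := Fin.ext (by omega)
      exact h.1
    convert hasSum_single c0 fun c hc => absurd (hsub c) hc
    simp [LeftChain.term, LeftChain.weight, c0, wt, det_partMatrix_zero hF0]
  | succ k ih =>
    intro s F hk hs hF hF0 hsum
    have hx : ∀ i : ℕ, ‖q ^ (s + i)‖ < 1 := fun i => by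
      rw [norm_pow]
      exact pow_lt_one₀ (norm_nonneg q) hq (by omega)
    let e := Equiv.ofBijective _ (LeftChain.extend_bijective (m := M + 1) (k := k))
    have hfib := LeftChain.hasSum_term_extend (Nat.le_of_succ_le_succ hk) hs hq hF hF0
    have hsum' := (e.summable_iff.2 hsum)
    have hsig := hsum'.hasSum.sigma hfib
    by_cases hA : evalAt F (q ^ s) = 0
    · simp only [hA, zero_mul] at hsig
      rw [Fin.prod_univ_succ]
      simp only [Fin.val_zero, add_zero, hA, zero_mul]
      rw [← hsig.unique hasSum_zero]
      exact e.hasSum_iff.1 hsum'.hasSum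
    have hG := ih (s + 1) (F := oneSubMulX (q * q ^ s) * F) (by omega) (by omega)
      ((discSummable_oneSubMulX _).mul hF) (by rw [map_mul, constantCoeff_oneSubMulX, hF0, one_mul])
      ((summable_mul_left_iff hA).1 hsig.summable)
    have hval := hsig.unique (hG.mul_left (evalAt F (q ^ s)))
    have hfin := e.hasSum_iff.1 hsum'.hasSum
    rw [hval] at hfin
    refine (congrArg (HasSum _) ?_).mpr hfin
    rw [Fin.prod_univ_succ, Fin.prod_univ_succ, Fin.prod_Ioi_zero]
    simp only [Fin.prod_Ioi_succ, Fin.val_zero, add_zero, Fin.val_succ]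
    have hev : ∀ i : Fin k, evalAt (oneSubMulX (q * q ^ s) * F) (q ^ (s + 1 + (i : ℕ))) =
        (1 - q * q ^ s * q ^ (s + ((i : ℕ) + 1))) * evalAt F (q ^ (s + ((i : ℕ) + 1))) := by
      intro i
      rw [show s + 1 + (i : ℕ) = s + ((i : ℕ) + 1) by ring,
        evalAt_mul (discSummable_oneSubMulX _) hF (hx _), evalAt_oneSubMulX]
    simp only [hev, Finset.prod_mul_distrib]
    simp only [show ∀ i : ℕ, s + 1 + i = s + (i + 1) from fun i => by ring]
    ring

/-! ### Summability -/

lemma summable_pow_sum_fin {s : ℝ} (h0 : 0 ≤ s) (h1 : s < 1) (N : ℕ) :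
    Summable (fun v : Fin N → ℕ => s ^ (∑ i, v i)) := by
  induction N with
  | zero => exact Summable.of_finite
  | succ N ih =>
    rw [← (Fin.consEquiv fun _ : Fin (N + 1) => ℕ).summable_iff]
    refine ((summable_geometric_of_lt_one h0 h1).mul_of_nonneg ih (fun _ => pow_nonneg h0 _)
      fun _ => pow_nonneg h0 _).congr fun p => ?_
    simp [Fin.consEquiv, Fin.sum_univ_succ, pow_add]

lemma summable_pow_sum {ι : Type*} [Fintype ι] {s : ℝ} (h0 : 0 ≤ s) (h1 : s < 1) :
    Summable (fun v : ι → ℕ => s ^ (∑ i, v i)) := by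
  rw [← (Equiv.arrowCongr (Fintype.equivFin ι).symm (Equiv.refl ℕ)).summable_iff]
  refine (summable_pow_sum_fin h0 h1 (Fintype.card ι)).congr fun v => ?_
  simp only [Function.comp_apply, Equiv.arrowCongr_apply, Equiv.symm_symm, Equiv.refl_apply]
  rw [(Fintype.equivFin ι).sum_comp v]

lemma summable_pow_of_injective {P ι : Type*} [Fintype ι] {q : ℂ} (hq : ‖q‖ < 1) {E : P → ℕ}
    {enc : P → ι → ℕ} (hinj : Function.Injective enc) (hle : ∀ p i, enc p i ≤ E p) :
    Summable (fun p => q ^ E p) := by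
  set N := Fintype.card ι + 1 with hN
  set s : ℝ := ‖q‖ ^ (N : ℝ)⁻¹ with hs
  have h0 : 0 ≤ s := Real.rpow_nonneg (norm_nonneg q) _
  have h1 : s < 1 := Real.rpow_lt_one (norm_nonneg q) hq (by positivity)
  have hsN : s ^ N = ‖q‖ := Real.rpow_inv_natCast_pow (norm_nonneg q) (Nat.succ_ne_zero _)
  refine Summable.of_norm_bounded ((summable_pow_sum (ι := ι) h0 h1).comp_injective hinj)
    fun p => ?_
  rw [norm_pow, ← hsN, ← pow_mul]
  refine pow_le_pow_of_le_one h0 h1.le ?_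
  calc ∑ i, enc p i ≤ ∑ _i : ι, E p := Finset.sum_le_sum fun i _ => hle p i
    _ = Fintype.card ι * E p := by simp
    _ ≤ N * E p := Nat.mul_le_mul_right _ (Nat.le_succ _)

/-- The exponent of `q` attached to a symplectic plane partition. -/
def SympPP.exponent {m n : ℕ} (p : SympPP m n) : ℕ :=
  (∑ k : Fin m, wt (p.1.1 k.succ)) + (∑ k : Fin n, wt (p.1.2.1 k)) -
    ∑ k : Fin n, wt (p.1.2.2 k.castSucc)

lemma apply_le_wt {m : ℕ} (l : Fin m → ℕ) (i : Fin m) : l i ≤ wt l :=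
  Finset.single_le_sum (fun _ _ => Nat.zero_le _) (Finset.mem_univ i)

lemma SympPP.wt_last_le_exponent {M n : ℕ} (p : SympPP (M + 1) n) :
    wt (p.1.1 (Fin.last (M + 1))) ≤ p.exponent := by
  obtain ⟨⟨l, μ, ν⟩, -, -, -, -, -, -, -, -, hdown, -⟩ := p
  have h1 : wt (l (Fin.last (M + 1))) ≤ ∑ k : Fin (M + 1), wt (l k.succ) :=
    Finset.single_le_sum (f := fun k : Fin (M + 1) => wt (l k.succ)) (fun _ _ => Nat.zero_le _)
      (Finset.mem_univ (Fin.last M))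
  have h2 : ∑ k : Fin n, wt (ν k.castSucc) ≤ ∑ k : Fin n, wt (μ k) :=
    Finset.sum_le_sum fun k _ => Finset.sum_le_sum fun i _ => (hdown k).1 i
  simp only [SympPP.exponent]
  omega

lemma SympPP.entries_le {M n : ℕ} (p : SympPP (M + 1) n) (i : Fin (M + 1)) :
    (∀ k, p.1.1 k i ≤ p.exponent) ∧ (∀ k, p.1.2.1 k i ≤ p.exponent) ∧
      ∀ k, p.1.2.2 k i ≤ p.exponent := by
  have hlast := (apply_le_wt _ i).trans p.wt_last_le_exponent
  generalize p.exponent = E at hlast ⊢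
  revert hlast
  obtain ⟨⟨l, μ, ν⟩, -, -, -, -, -, heq, hl, hup, hdown, -⟩ := p
  intro hlast
  have hlm : Monotone fun k => l k i :=
    Fin.monotone_iff_le_succ.2 fun k => (hl k).1 i
  have hνm : Monotone fun k => ν k i :=
    Fin.monotone_iff_le_succ.2 fun k => ((hdown k).1 i).trans ((hup k).1 i)
  have hν : ∀ k, ν k i ≤ l (Fin.last (M + 1)) i := fun k => by
    have h := hνm (Fin.le_last k)
    simp only at heq
    rwa [heq]
  exact ⟨fun k => (hlm (Fin.le_last k)).trans hlast,
    fun k => (((hup k).1 i).trans (hν _)).trans hlast, fun k => (hν k).trans hlast⟩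

lemma SympPP.summable_pow_exponent {M n : ℕ} {q : ℂ} (hq : ‖q‖ < 1) :
    Summable (fun p : SympPP (M + 1) n => q ^ p.exponent) := by
  refine summable_pow_of_injective hq
    (ι := (Fin (M + 1 + 1) × Fin (M + 1)) ⊕ (Fin n × Fin (M + 1)) ⊕ (Fin (n + 1) × Fin (M + 1)))
    (enc := fun p => Sum.elim (fun x => p.1.1 x.1 x.2)
      (Sum.elim (fun x => p.1.2.1 x.1 x.2) fun x => p.1.2.2 x.1 x.2)) ?_ ?_
  · intro p p' h
    refine Subtype.ext (Prod.ext ?_ (Prod.ext ?_ ?_))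
    · funext k i
      exact congrFun h (Sum.inl (k, i))
    · funext k i
      exact congrFun h (Sum.inr (Sum.inl (k, i)))
    · funext k i
      exact congrFun h (Sum.inr (Sum.inr (k, i)))
  · rintro p (⟨k, i⟩ | ⟨k, i⟩ | ⟨k, i⟩)
    · exact (p.entries_le i).1 k
    · exact (p.entries_le i).2.1 k
    · exact (p.entries_le i).2.2 k

/-! ### Gluing left and right chains -/

/-- Glue a left chain and a right chain to a symplectic plane partition. -/
def SympPP.ofChains {M n : ℕ}
    (p : Σ c : LeftChain (M + 1) (M + 1), RightChain n (c.1 (Fin.last (M + 1)))) :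
    SympPP (M + 1) n :=
  ⟨(p.1.1, p.2.1.1, p.2.1.2), p.1.antitone, fun k => (p.2.2.2.2.1 k).antitone_right,
    fun k => by
      refine Fin.cases ?_ (fun k => (p.2.2.2.2.1 k).antitone_left) k
      simp only [p.2.2.1]
      exact antitone_const,
    p.1.2.1, p.2.2.1, p.2.2.2.1.symm, p.1.2.2, p.2.2.2.2.1, p.2.2.2.2.2.1, p.2.2.2.2.2.2⟩

lemma SympPP.ofChains_bijective {M n : ℕ} :
    Function.Bijective (SympPP.ofChains (M := M) (n := n)) := by
  constructor
  · rintro ⟨⟨c, hc⟩, ⟨r, hr⟩⟩ ⟨⟨c', hc'⟩, ⟨r', hr'⟩⟩ h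
    obtain rfl : c = c' := congrArg (fun p => p.1.1) h
    obtain rfl : r = r' := congrArg (fun p => p.1.2) h
    rfl
  · rintro ⟨⟨l, μ, ν⟩, -, -, -, hl0, hν0, heq, hl, hup, hdown, hlen⟩
    exact ⟨⟨⟨l, hl0, hl⟩, ⟨(μ, ν), hν0, heq.symm, hup, hdown, hlen⟩⟩, rfl⟩

lemma SympPP.exponent_ofChains {M n : ℕ} (c : LeftChain (M + 1) (M + 1))
    (r : RightChain n (c.1 (Fin.last (M + 1)))) :
    (SympPP.ofChains ⟨c, r⟩).exponent = c.weight + wt (c.1 (Fin.last (M + 1))) + r.weight := by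
  have hleft : ∑ k : Fin (M + 1), wt (c.1 k.succ) = c.weight + wt (c.1 (Fin.last (M + 1))) := by
    have h := (Fin.sum_univ_succ fun k => wt (c.1 k)).symm.trans
      (Fin.sum_univ_castSucc fun k => wt (c.1 k))
    have h0 : wt (c.1 0) = 0 := by simp [c.2.1, wt]
    rw [h0, zero_add] at h
    exact h
  have hright : ∑ k : Fin n, wt (r.1.1 k) =
      (∑ k : Fin n, wt (r.1.2 k.castSucc)) + r.weight := by
    rw [RightChain.weight, ← Finset.sum_add_distrib]
    exact Finset.sum_congr rfl fun k _ => (r.2.2.2.2.1 k).wt_eq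
  change (∑ k : Fin (M + 1), wt (c.1 k.succ)) + (∑ k : Fin n, wt (r.1.1 k)) -
    ∑ k : Fin n, wt (r.1.2 k.castSucc) = _
  rw [hleft, hright]
  omega

lemma evalAt_invQuadPoly_pow {q x : ℂ} (hq : ‖q‖ < 1) (hx : ‖x‖ < 1) (n : ℕ) :
    evalAt (invQuadPoly q ^ n) x = ((1 - x) ^ n * (1 - q * x) ^ n)⁻¹ := by
  have hF : DiscSummable (invQuadPoly q) :=
    (discSummable_geomPowerSeries (by simp)).mul (discSummable_geomPowerSeries hq.le)
  have h := evalAt_mul (discSummable_quadPoly q) hF hx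
  rw [quadPoly_mul_invQuadPoly, evalAt_one, evalAt_quadPoly q hx] at h
  rw [evalAt_pow hF hx, eq_inv_of_mul_eq_one_right h.symm, inv_pow, mul_pow]

lemma SympPP.hasSum_pow_exponent {M n : ℕ} (hmn : M + 1 ≤ n) {q : ℂ} (hq : ‖q‖ < 1) :
    HasSum (fun p : SympPP (M + 1) n => q ^ p.exponent)
      ((∏ i : Fin (M + 1), evalAt (invQuadPoly q ^ n) (q ^ (1 + (i : ℕ)))) *
        ∏ i : Fin (M + 1), ∏ j ∈ Finset.Ioi i,
          (1 - q * q ^ (1 + (i : ℕ)) * q ^ (1 + (j : ℕ)))) := by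
  let e := Equiv.ofBijective _ (SympPP.ofChains_bijective (M := M) (n := n))
  have hsum := e.summable_iff.2 (SympPP.summable_pow_exponent (M := M) (n := n) hq)
  have hfib : ∀ c : LeftChain (M + 1) (M + 1), HasSum
      (fun r : RightChain n (c.1 (Fin.last (M + 1))) => q ^ (SympPP.ofChains ⟨c, r⟩).exponent)
      (c.term q 1 (invQuadPoly q ^ n)) := by
    intro c
    rw [LeftChain.term, pow_one, ← pow_add]
    refine ((hasSum_rightChain q n (c.antitone _)
      fun i hi => absurd i.2 (by omega)).mul_left _).congr_fun fun r => ?_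
    rw [SympPP.exponent_ofChains, pow_add]
  have hsig := hsum.hasSum.sigma hfib
  have hval := hsig.unique (LeftChain.hasSum_term hq (M + 1) 1 le_rfl one_ne_zero
    (((discSummable_geomPowerSeries (by simp)).mul (discSummable_geomPowerSeries hq.le)).pow n)
    (by rw [map_pow, constantCoeff_invQuadPoly, one_pow]) hsig.summable)
  rw [← hval]
  exact e.hasSum_iff.1 hsum.hasSum

/-- **Volume generating series of symplectic plane partitions** (equation (13) of the
paper): for `1 ≤ m ≤ n`,
`Σ q^{Σᵢ|λ⁽ⁱ⁾| + Σⱼ|μ⁽ʲ⁾| - Σ_{j<n}|ν̄⁽ʲ⁾|}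
  = ∏_{1≤i<j≤m} (1-q^{i+j+1}) / ∏_{i=1}^m (1-qⁱ)ⁿ (1-q^{i+1})ⁿ`,
the sum being over symplectic plane partitions in the `m × 2n` box, as an identity of
(convergent) power series in `q`. -/
theorem symplectic_plane_partition_volume_series (m n : ℕ) (hm : 1 ≤ m) (hmn : m ≤ n)
    (q : ℂ) (hq : ‖q‖ < 1) :
    HasSum
      (fun p : SympPP m n =>
        q ^ ((∑ k : Fin m, wt (p.1.1 k.succ)) + (∑ k : Fin n, wt (p.1.2.1 k)) -
          ∑ k : Fin n, wt (p.1.2.2 k.castSucc)))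
      ((∏ i : Fin m, ∏ j ∈ Finset.Ioi i, (1 - q ^ ((i : ℕ) + (j : ℕ) + 3))) /
        ∏ i : Fin m, ((1 - q ^ ((i : ℕ) + 1)) ^ n * (1 - q ^ ((i : ℕ) + 2)) ^ n)) := by
  obtain ⟨M, rfl⟩ : ∃ M, m = M + 1 := ⟨m - 1, by omega⟩
  refine (congrArg (HasSum _) ?_).mpr (SympPP.hasSum_pow_exponent hmn hq)
  rw [div_eq_inv_mul, ← Finset.prod_inv_distrib]
  congr 1
  · refine Finset.prod_congr rfl fun i _ => ?_
    rw [evalAt_invQuadPoly_pow hq, add_comm 1, ← pow_succ']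
    rw [norm_pow]
    exact pow_lt_one₀ (norm_nonneg q) hq (by omega)
  · refine Finset.prod_congr rfl fun i _ => Finset.prod_congr rfl fun j _ => ?_
    rw [← pow_succ', ← pow_add]
    congr 2
    ring
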